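/- Let p be an odd prime, s ≥ 0, n ≥ 1, and 1 ≤ m < p/2 integers. Define the normalized Apéry-like numbers by tJ_{2s+2}(N) = Σ_{k=0}^N (−1)^k C(−1/2,k)² C(N,k) Z^even_s(k), where Z^even_0(k) = 1 and Z^even_s(k) = (−1)^s Σ_{k > j₁ > ⋯ > j_s ≥ 0} Π_i (j_i+1/2)^{−2} for s ≥ 1. Then p^{2sn} tJ_{2s+2}(m p^n) ≡ p^{2s(n−1)} tJ_{2s+2}(m p^{n−1}) (mod p^n). -/

import Mathlib

/-- Generalized binomial coefficient `C(-1/2, m)`. -/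
noncomputable def negHalfChoose (m : ℕ) : ℚ :=
  (∏ i ∈ Finset.range m, (-1/2 - (i : ℚ))) / (m.factorial : ℚ)

/-- `Z^even_s(k)`; for `s = 0` this is `1`, and for `s ≥ 1` it is
`(−1)^s Σ_{k > j₁ > ⋯ > j_s ≥ 0} Π (j_i + 1/2)^{−2}` (strictly decreasing tuples below `k`
identified with `s`-element subsets of `{0,…,k−1}`). -/
def Zeven (s k : ℕ) : ℚ :=
  (-1) ^ s * ∑ T ∈ Finset.powersetCard s (Finset.range k),
    ∏ j ∈ T, (1 / ((j : ℚ) + 1/2) ^ 2)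

/-- The normalized Apéry-like numbers `tJ_{2s+2}(N)`. -/
noncomputable def tJeven (s N : ℕ) : ℚ :=
  ∑ k ∈ Finset.range (N + 1),
    (-1) ^ k * (negHalfChoose k) ^ 2 * (N.choose k : ℚ) * Zeven s k

/-- `x` is divisible by `p ^ n` in the localization of `ℤ` at `p`. -/
def DivP (p n : ℕ) (x : ℚ) : Prop := padicNorm p x ≤ (p : ℚ) ^ (-(n : ℤ))

section aux
variable {p : ℕ} [hp : Fact p.Prime]

lemma DivP.of_int {n : ℕ} {z : ℤ} (h : (p : ℤ) ^ n ∣ z) : DivP p n (z : ℚ) := by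
  unfold DivP
  rw [← padicNorm.dvd_iff_norm_le]
  exact_mod_cast h

lemma DivP.int (z : ℤ) : DivP p 0 (z : ℚ) := DivP.of_int (by simp)

lemma DivP.mul {a b : ℕ} {x y : ℚ} (hx : DivP p a x) (hy : DivP p b y) :
    DivP p (a + b) (x * y) := by
  unfold DivP at *
  have h0 : (p : ℚ) ≠ 0 := by exact_mod_cast hp.out.ne_zero
  rw [padicNorm.mul]
  push_cast
  rw [neg_add, zpow_add₀ h0]
  exact mul_le_mul hx hy (padicNorm.nonneg _) (by positivity)

lemma DivP.zero (n : ℕ) : DivP p n 0 := by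
  unfold DivP
  rw [padicNorm.zero]; positivity

lemma DivP.add {n : ℕ} {x y : ℚ} (hx : DivP p n x) (hy : DivP p n y) :
    DivP p n (x + y) :=
  le_trans (padicNorm.nonarchimedean) (max_le hx hy)

lemma DivP.sum {ι : Type*} {n : ℕ} {S : Finset ι} {f : ι → ℚ}
    (h : ∀ i ∈ S, DivP p n (f i)) : DivP p n (∑ i ∈ S, f i) := by
  classical
  induction S using Finset.induction_on with
  | empty => simpa using DivP.zero n
  | insert a S ha ih =>
    rw [Finset.sum_insert ha]
    exact (h a (by simp)).add (ih fun i hi => h i (by simp [hi]))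

lemma DivP.prod {ι : Type*} {S : Finset ι} {f : ι → ℚ}
    (h : ∀ i ∈ S, DivP p 0 (f i)) : DivP p 0 (∏ i ∈ S, f i) := by
  classical
  induction S using Finset.induction_on with
  | empty => simpa using DivP.int (p := p) 1
  | insert a S ha ih =>
    rw [Finset.prod_insert ha]
    exact (h a (by simp)).mul (ih fun i hi => h i (by simp [hi]))

lemma DivP.mono {a b : ℕ} (hab : a ≤ b) {x : ℚ} (h : DivP p b x) : DivP p a x := by
  unfold DivP at *
  refine h.trans (zpow_le_zpow_right₀ ?_ (by omega))
  exact_mod_cast hp.out.one_lt.le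

lemma DivP.div_unit {n : ℕ} {x : ℚ} (h : DivP p n x) {u : ℕ} (hu : ¬ p ∣ u) :
    DivP p n (x / u) := by
  unfold DivP at *
  rw [padicNorm.div, (padicNorm.nat_eq_one_iff u).2 hu, div_one]
  exact h

lemma DivP.final {n : ℕ} {x y : ℚ} (h : DivP p n (x - y)) :
    x = y ∨ (n : ℤ) ≤ padicValRat p (x - y) := by
  by_cases hxy : x = y
  · exact Or.inl hxy
  right
  unfold DivP at h
  rw [padicNorm.eq_zpow_of_nonzero (sub_ne_zero.2 hxy)] at h
  have h1 : (1 : ℚ) < p := by exact_mod_cast hp.out.one_lt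
  have := (zpow_le_zpow_iff_right₀ h1).1 h
  omega

/-- quotient of `p^n` by a small number is integral -/
lemma divP_quot {n c : ℕ} (hc : 0 < c) (hcn : c < p ^ (n + 1)) :
    DivP p 0 ((p : ℚ) ^ n / c) := by
  obtain ⟨v, u, hu, rfl⟩ := Nat.exists_eq_pow_mul_and_not_dvd hc.ne' p hp.out.ne_one
  have hv : v ≤ n := by
    by_contra hv
    have h1 : p ^ (n + 1) ≤ p ^ v := Nat.pow_le_pow_right hp.out.pos (by omega)
    have h2 : p ^ v ≤ p ^ v * u :=
      Nat.le_mul_of_pos_right _ (Nat.pos_of_ne_zero (by rintro rfl; simp at hu))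
    omega
  have h0 : (p : ℚ) ≠ 0 := by exact_mod_cast hp.out.ne_zero
  have e : (p : ℚ) ^ n / ((p ^ v * u : ℕ) : ℚ) = (((p : ℤ) ^ (n - v) : ℤ) : ℚ) / u := by
    obtain ⟨w, rfl⟩ := Nat.exists_eq_add_of_le hv
    have hu0 : (u : ℚ) ≠ 0 := by
      rintro h
      have : u = 0 := by exact_mod_cast h
      subst this; simp at hu
    push_cast
    rw [show v + w - v = w by omega, pow_add]
    field_simp
  rw [e]
  exact (DivP.int _).div_unit hu

open Polynomial in
/-- coefficientwise comparison of `(1+X)^(pA)` and `(1+X^p)^A` -/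
lemma poly_cong {A r : ℕ} (hA : p ^ r ∣ A) :
    ((p : ℤ[X]) ^ (r + 1)) ∣ ((1 + X) ^ (p * A) - (1 + X ^ p) ^ A : ℤ[X]) := by
  have h1 : (p : ℤ[X]) ∣ ((1 + X) ^ p - (1 + X ^ p) : ℤ[X]) := by
    obtain ⟨g, hg⟩ := exists_add_pow_prime_eq hp.out (1 : ℤ[X]) X
    refine ⟨X * g, ?_⟩
    rw [hg]; ring
  have h2 := dvd_sub_pow_of_dvd_sub h1 r
  obtain ⟨B, rfl⟩ := hA
  refine h2.trans ?_
  rw [← mul_assoc, pow_mul (1 + X) (p * p ^ r) B, pow_mul (1 + X) p (p ^ r),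
    pow_mul (1 + X ^ p) (p ^ r) B]
  exact sub_dvd_pow_sub_pow _ _ _

open Polynomial in
lemma coeff_aux (A k : ℕ) : (((1 + X ^ p) ^ A : ℤ[X])).coeff k =
    if p ∣ k then (A.choose (k / p) : ℤ) else 0 := by
  have : ((1 + X ^ p) ^ A : ℤ[X]) = expand ℤ p ((1 + X) ^ A) := by simp
  rw [this, coeff_expand hp.out.pos]
  split_ifs <;> simp [coeff_one_add_X_pow]

open Polynomial in
lemma choose_cong {A r : ℕ} (hA : p ^ r ∣ A) (k : ℕ) :
    ((p : ℤ) ^ (r + 1)) ∣ (((p * A).choose k : ℤ) -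
      if p ∣ k then (A.choose (k / p) : ℤ) else 0) := by
  have h := poly_cong hA
  have h' : (C ((p : ℤ) ^ (r + 1))) ∣ ((1 + X) ^ (p * A) - (1 + X ^ p) ^ A : ℤ[X]) := by
    simpa using h
  have := (C_dvd_iff_dvd_coeff _ _).1 h' k
  rwa [coeff_sub, coeff_aux, coeff_one_add_X_pow] at this

lemma negHalf_eq (k : ℕ) : negHalfChoose k ^ 2 = (k.centralBinom : ℚ) ^ 2 / (16 ^ k : ℕ) := by
  have h : negHalfChoose k = (-1) ^ k * (k.centralBinom : ℚ) / 4 ^ k := by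
    induction k with
    | zero => simp [negHalfChoose]
    | succ k ih =>
      have hs := Nat.succ_mul_centralBinom_succ k
      have hs' : ((k : ℚ) + 1) * ((k + 1).centralBinom : ℚ) =
        2 * (2 * k + 1) * (k.centralBinom : ℚ) := by exact_mod_cast hs
      have hk : (k : ℚ) + 1 ≠ 0 := by positivity
      have e : negHalfChoose (k + 1) = negHalfChoose k * ((-1/2 - k) / (k + 1)) := by
        unfold negHalfChoose
        rw [Finset.prod_range_succ, Nat.factorial_succ]
        have : (k.factorial : ℚ) ≠ 0 := by exact_mod_cast k.factorial_ne_zero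
        push_cast
        field_simp
      have e2 : ((k + 1).centralBinom : ℚ) =
        2 * (2 * k + 1) * (k.centralBinom : ℚ) / (k + 1) := by
        field_simp; linarith
      rw [e, ih, e2]
      field_simp
      ring
  have h16 : ((4 : ℚ) ^ k) ^ 2 = 16 ^ k := by
    rw [← pow_mul, mul_comm, pow_mul]; norm_num
  rw [h, div_pow, mul_pow, h16, ← pow_mul, mul_comm k 2, pow_mul]
  push_cast
  norm_num

lemma not_dvd_sixteen (hodd : Odd p) (k : ℕ) : ¬ p ∣ 16 ^ k := by
  intro h
  have h1 := hp.out.dvd_of_dvd_pow h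
  have h2 : p ∣ 2 := hp.out.dvd_of_dvd_pow (n := 4) (by simpa using h1)
  have h3 := (Nat.prime_dvd_prime_iff_eq hp.out Nat.prime_two).1 h2
  subst h3
  exact absurd hodd (by decide)

lemma divP_a (hodd : Odd p) (k : ℕ) : DivP p 0 (negHalfChoose k ^ 2) := by
  rw [negHalf_eq]
  refine DivP.div_unit ?_ (not_dvd_sixteen hodd k)
  have := DivP.int (p := p) (((k.centralBinom ^ 2 : ℕ) : ℤ))
  push_cast at this
  exact this

lemma divP_a_sub (hodd : Odd p) {k v : ℕ} (hk : p ^ v ∣ k) :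
    DivP p (v + 1) (negHalfChoose (p * k) ^ 2 - negHalfChoose k ^ 2) := by
  have e : negHalfChoose (p * k) ^ 2 - negHalfChoose k ^ 2 =
      (((((p * k).centralBinom : ℤ) ^ 2 * 16 ^ k - (k.centralBinom : ℤ) ^ 2 * 16 ^ (p * k) : ℤ) : ℚ))
        / ((16 ^ (p * k + k) : ℕ) : ℚ) := by
    rw [negHalf_eq, negHalf_eq]
    push_cast
    rw [pow_add]
    field_simp
  rw [e]
  refine DivP.div_unit (DivP.of_int ?_) (not_dvd_sixteen hodd _)
  have h1 : ((p : ℤ) ^ (v + 1)) ∣ ((p * k).centralBinom : ℤ) - k.centralBinom := by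
    have := choose_cong (p := p) (A := 2 * k) (r := v) (hk.mul_left 2) (p * k)
    rw [if_pos (dvd_mul_right _ _), Nat.mul_div_cancel_left _ hp.out.pos] at this
    rw [Nat.centralBinom, Nat.centralBinom, show 2 * (p * k) = p * (2 * k) by ring]
    exact this
  have h2 : ((p : ℤ) ^ (v + 1)) ∣ (16 : ℤ) ^ (p * k) - 16 ^ k := by
    have hf : (p : ℤ) ∣ (16 : ℤ) ^ p - 16 := by
      rw [← ZMod.intCast_zmod_eq_zero_iff_dvd]
      push_cast
      rw [ZMod.pow_card, sub_self]
    have h3 := dvd_sub_pow_of_dvd_sub hf v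
    obtain ⟨B, rfl⟩ := hk
    refine h3.trans ?_
    rw [← mul_assoc, pow_mul, pow_mul, pow_mul (16 : ℤ) (p ^ v) B]
    exact sub_dvd_pow_sub_pow _ _ _
  have e2 : ((p * k).centralBinom : ℤ) ^ 2 * 16 ^ k - (k.centralBinom : ℤ) ^ 2 * 16 ^ (p * k)
     = (((p * k).centralBinom : ℤ) - k.centralBinom) *
        ((((p * k).centralBinom : ℤ) + k.centralBinom) * 16 ^ k)
       - (k.centralBinom : ℤ) ^ 2 * ((16 : ℤ) ^ (p * k) - 16 ^ k) := by ring
  rw [e2]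
  exact dvd_sub (h1.mul_right _) (h2.mul_left _)

/-- the product `C(A,k) (a_{pk} - a_k)` -/
lemma divP_choose_a (hodd : Odd p) {A r k : ℕ} (hA : p ^ r ∣ A) :
    DivP p (r + 1) ((A.choose k : ℚ) * (negHalfChoose (p * k) ^ 2 - negHalfChoose k ^ 2)) := by
  rcases Nat.eq_zero_or_pos k with rfl | hk
  · simpa using DivP.zero (p := p) (r + 1)
  obtain ⟨v, u, hu, rfl⟩ := Nat.exists_eq_pow_mul_and_not_dvd hk.ne' p hp.out.ne_one
  have h1 := divP_a_sub (p := p) hodd (k := p ^ v * u) (v := v) (dvd_mul_right _ _)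
  set k := p ^ v * u with hkdef
  have h2 : p ^ r ∣ A.choose k * p ^ v := by
    have h3 : p ^ r ∣ A.choose k * k := by
      obtain ⟨j, hj⟩ := Nat.exists_eq_succ_of_ne_zero hk.ne'
      rcases Nat.eq_zero_or_pos A with rfl | hA0
      · rw [hj]; simp
      obtain ⟨B, rfl⟩ := Nat.exists_eq_succ_of_ne_zero hA0.ne'
      rw [hj, Nat.succ_eq_add_one, Nat.succ_eq_add_one, ← Nat.add_one_mul_choose_eq]
      exact hA.mul_right _
    rw [hkdef, ← mul_assoc] at h3
    refine Nat.Coprime.dvd_of_dvd_mul_right ?_ h3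
    exact Nat.Coprime.pow_left _ ((Nat.Prime.coprime_iff_not_dvd hp.out).2 hu)
  rcases le_total r v with hrv | hrv
  · have := (DivP.int (p := p) (A.choose k : ℤ)).mul h1
    have h6 : r + 1 ≤ 0 + (v + 1) := by omega
    exact DivP.mono h6 (by exact_mod_cast this)
  · obtain ⟨w, rfl⟩ := Nat.exists_eq_add_of_le hrv
    have h4 : p ^ w ∣ A.choose k := by
      rw [pow_add, mul_comm] at h2
      exact Nat.dvd_of_mul_dvd_mul_right (pow_pos hp.out.pos v) h2
    have h5 : DivP p w ((A.choose k : ℤ) : ℚ) := DivP.of_int (by exact_mod_cast h4)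
    have := h5.mul h1
    rw [show v + w + 1 = w + (v + 1) by ring]
    exact_mod_cast this

lemma Zscale (s n k : ℕ) : (p : ℚ) ^ (2 * s * n) * Zeven s k =
    (-1) ^ s * ∑ T ∈ Finset.powersetCard s (Finset.range k),
      ∏ j ∈ T, (4 * (((p : ℚ) ^ n / ((2 * j + 1 : ℕ) : ℚ)) * ((p : ℚ) ^ n / ((2 * j + 1 : ℕ) : ℚ)))) := by
  unfold Zeven
  rw [mul_left_comm, Finset.mul_sum]
  congr 1
  refine Finset.sum_congr rfl fun T hT => ?_
  have hc := (Finset.mem_powersetCard.1 hT).2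
  have : (p : ℚ) ^ (2 * s * n) = ∏ j ∈ T, (p : ℚ) ^ (2 * n) := by
    rw [Finset.prod_const, hc, ← pow_mul]; ring_nf
  rw [this, ← Finset.prod_mul_distrib]
  refine Finset.prod_congr rfl fun j _ => ?_
  have h1 : (j : ℚ) + 1 / 2 ≠ 0 := by positivity
  have h2 : 2 * (j : ℚ) + 1 ≠ 0 := by positivity
  push_cast
  field_simp
  ring

lemma divP_f {n j : ℕ} (h : 2 * j + 1 < p ^ (n + 1)) :
    DivP p 0 (4 * (((p : ℚ) ^ n / ((2 * j + 1 : ℕ) : ℚ)) * ((p : ℚ) ^ n / ((2 * j + 1 : ℕ) : ℚ)))) := by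
  have h1 := divP_quot (p := p) (n := n) (c := 2 * j + 1) (by omega) h
  exact_mod_cast (DivP.int (p := p) 4).mul (h1.mul h1)

lemma divP_Z {s n k : ℕ} (h : 2 * k < p ^ (n + 1)) :
    DivP p 0 ((p : ℚ) ^ (2 * s * n) * Zeven s k) := by
  rw [Zscale]
  have h1 : DivP p 0 (∑ T ∈ Finset.powersetCard s (Finset.range k),
      ∏ j ∈ T, (4 * (((p : ℚ) ^ n / ((2 * j + 1 : ℕ) : ℚ)) *
        ((p : ℚ) ^ n / ((2 * j + 1 : ℕ) : ℚ))))) := by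
    refine DivP.sum fun T hT => DivP.prod fun j hj => divP_f ?_
    have := Finset.mem_range.1 ((Finset.mem_powersetCard.1 hT).1 hj)
    omega
  exact_mod_cast (DivP.int (p := p) ((-1) ^ s)).mul h1

lemma divP_Z_sub (hodd : Odd p) {s r k : ℕ} (h : 2 * (p * k) < p ^ (r + 1 + 1)) :
    DivP p (r + 1) ((p : ℚ) ^ (2 * s * (r + 1)) * Zeven s (p * k)
      - (p : ℚ) ^ (2 * s * r) * Zeven s k) := by
  obtain ⟨q, hq⟩ := hodd
  have hp0 : 0 < p := hp.out.pos
  rw [Zscale, Zscale, ← mul_sub]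
  set f : ℕ → ℚ := fun j => 4 * (((p : ℚ) ^ (r + 1) / ((2 * j + 1 : ℕ) : ℚ)) *
    ((p : ℚ) ^ (r + 1) / ((2 * j + 1 : ℕ) : ℚ))) with hf
  have hinj : Function.Injective (fun j : ℕ => p * j + q) := by
    intro a b hab
    exact Nat.eq_of_mul_eq_mul_left hp0 (Nat.add_right_cancel hab)
  let φ : ℕ ↪ ℕ := ⟨fun j => p * j + q, hinj⟩
  have hφ : ∀ j, φ j = p * j + q := fun _ => rfl
  have hsub : (Finset.range k).map φ ⊆ Finset.range (p * k) := by
    intro x hx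
    obtain ⟨j, hj, rfl⟩ := Finset.mem_map.1 hx
    rw [Finset.mem_range] at *
    rw [hφ]
    have : p * (j + 1) ≤ p * k := Nat.mul_le_mul_left _ hj
    rw [mul_add] at this
    omega
  have hsum : ∑ T ∈ Finset.powersetCard s (Finset.range k),
      ∏ j ∈ T, (4 * (((p : ℚ) ^ r / ((2 * j + 1 : ℕ) : ℚ)) *
        ((p : ℚ) ^ r / ((2 * j + 1 : ℕ) : ℚ)))) =
      ∑ T ∈ Finset.powersetCard s ((Finset.range k).map φ), ∏ j ∈ T, f j := by
    rw [Finset.powersetCard_map, Finset.sum_map]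
    refine Finset.sum_congr rfl fun T _ => ?_
    simp only [Finset.mapEmbedding_apply, RelEmbedding.coe_toEmbedding, Finset.prod_map]
    refine Finset.prod_congr rfl fun j _ => ?_
    have e : 2 * (φ j) + 1 = p * (2 * j + 1) := by
      rw [hφ]
      have : p * (2 * j + 1) = 2 * (p * j) + p := by ring
      omega
    have hp0' : (p : ℚ) ≠ 0 := by exact_mod_cast hp0.ne'
    have e2 : (p : ℚ) ^ (r + 1) / ((2 * (φ j) + 1 : ℕ) : ℚ) = (p : ℚ) ^ r / ((2 * j + 1 : ℕ) : ℚ) := by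
      rw [e, pow_succ, Nat.cast_mul, mul_comm, mul_div_mul_left _ _ hp0']
    simp only [hf]
    rw [e2]
  rw [hsum, ← Finset.sum_sdiff (Finset.powersetCard_mono hsub), add_sub_cancel_right]
  have hfInt : ∀ j ∈ Finset.range (p * k), DivP p 0 (f j) := by
    intro j hj
    refine divP_f ?_
    have := Finset.mem_range.1 hj
    omega
  have key : DivP p (r + 1) (∑ T ∈ Finset.powersetCard s (Finset.range (p * k)) \
      Finset.powersetCard s ((Finset.range k).map φ), ∏ j ∈ T, f j) := by
    refine DivP.sum fun T hT => ?_
    rw [Finset.mem_sdiff, Finset.mem_powersetCard, Finset.mem_powersetCard] at hT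
    obtain ⟨⟨hT1, hT2⟩, hT3⟩ := hT
    have : ¬ T ⊆ (Finset.range k).map φ := fun h => hT3 ⟨h, hT2⟩
    obtain ⟨j, hjT, hj⟩ := Finset.not_subset.1 this
    rw [← Finset.mul_prod_erase T f hjT]
    have hpj : ¬ p ∣ 2 * j + 1 := by
      rintro ⟨c, hc⟩
      apply hj
      have hco : Odd c := by
        by_contra hcc
        rw [Nat.not_odd_iff_even] at hcc
        obtain ⟨d, hd⟩ := hcc
        have : p * c = 2 * (p * d) := by rw [hd]; ring
        omega
      obtain ⟨d, hd⟩ := hco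
      have e : p * c = 2 * (p * d) + p := by rw [hd]; ring
      have hjd : j = p * d + q := by omega
      refine Finset.mem_map.2 ⟨d, ?_, by rw [hφ, hjd]⟩
      rw [Finset.mem_range]
      have := Finset.mem_range.1 (hT1 hjT)
      exact Nat.lt_of_mul_lt_mul_left (a := p) (by omega)
    have hq1 : DivP p (r + 1) ((p : ℚ) ^ (r + 1) / ((2 * j + 1 : ℕ) : ℚ)) := by
      refine DivP.div_unit ?_ hpj
      exact_mod_cast DivP.of_int (p := p) (dvd_refl ((p : ℤ) ^ (r + 1)))
    have h1 : DivP p (r + 1) (f j) := by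
      have := (DivP.int (p := p) 4).mul (hq1.mul hq1)
      have h2 : r + 1 ≤ 0 + (r + 1 + (r + 1)) := by omega
      exact DivP.mono h2 this
    have h3 : DivP p 0 (∏ i ∈ T.erase j, f i) :=
      DivP.prod fun i hi => hfInt i (hT1 (Finset.mem_of_mem_erase hi))
    have h4 := h1.mul h3
    rw [add_zero] at h4
    exact h4
  have := (DivP.int (p := p) ((-1) ^ s)).mul key
  rw [zero_add] at this
  exact_mod_cast this

lemma main_aux (hodd : Odd p) {s r A : ℕ} (hA : p ^ r ∣ A) (hAp : 2 * (p * A) < p ^ (r + 1 + 1)) :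
    DivP p (r + 1) ((p : ℚ) ^ (2 * s * (r + 1)) * tJeven s (p * A)
      - (p : ℚ) ^ (2 * s * r) * tJeven s A) := by
  have hp0 : 0 < p := hp.out.pos
  unfold tJeven
  rw [Finset.mul_sum, Finset.mul_sum]
  set F : ℕ → ℚ := fun k => (p : ℚ) ^ (2 * s * (r + 1)) *
    ((-1) ^ k * negHalfChoose k ^ 2 * ((p * A).choose k : ℚ) * Zeven s k) with hF
  let φ : ℕ ↪ ℕ := ⟨fun j => p * j, fun a b h => Nat.eq_of_mul_eq_mul_left hp0 h⟩
  have hφ : ∀ j, φ j = p * j := fun _ => rfl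
  have hsub : (Finset.range (A + 1)).map φ ⊆ Finset.range (p * A + 1) := by
    intro x hx
    obtain ⟨j, hj, rfl⟩ := Finset.mem_map.1 hx
    rw [Finset.mem_range] at *
    rw [hφ]
    have : p * j ≤ p * A := Nat.mul_le_mul_left _ (by omega)
    omega
  rw [← Finset.sum_sdiff hsub, Finset.sum_map, add_sub_assoc, ← Finset.sum_sub_distrib]
  refine DivP.add (DivP.sum fun k hk => ?_) (DivP.sum fun k hk => ?_)
  · rw [Finset.mem_sdiff, Finset.mem_range] at hk
    obtain ⟨hk1, hk2⟩ := hk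
    have hpk : ¬ p ∣ k := by
      rintro ⟨c, rfl⟩
      refine hk2 (Finset.mem_map.2 ⟨c, ?_, rfl⟩)
      rw [Finset.mem_range]
      have : c ≤ A := Nat.le_of_mul_le_mul_left (Nat.lt_succ_iff.1 hk1) hp0
      omega
    have h1 := choose_cong (p := p) hA k
    rw [if_neg hpk, sub_zero] at h1
    have h2 := (((DivP.of_int h1).mul (divP_a hodd k)).mul
      (divP_Z (p := p) (s := s) (n := r + 1) (k := k) (by omega))).mul
        (DivP.int (p := p) ((-1) ^ k))
    simp only [add_zero] at h2
    convert h2 using 1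
    push_cast
    ring
  · have hk' : k ≤ A := by have := Finset.mem_range.1 hk; omega
    have hpk : p * k ≤ p * A := Nat.mul_le_mul_left _ hk'
    have h1 := choose_cong (p := p) hA (p * k)
    rw [if_pos (dvd_mul_right _ _), Nat.mul_div_cancel_left _ hp0] at h1
    have hX := divP_Z (p := p) (s := s) (n := r + 1) (k := p * k) (by omega)
    have hXY := divP_Z_sub (p := p) hodd (s := s) (r := r) (k := k) (by omega)
    have t1 := ((DivP.of_int h1).mul (divP_a hodd (p * k))).mul hX
    have t2 := (divP_choose_a (p := p) hodd (k := k) hA).mul hX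
    have t3 := ((divP_a hodd k).mul (DivP.int (p := p) (A.choose k : ℤ))).mul hXY
    simp only [add_zero, zero_add] at t1 t2 t3
    have t := (DivP.int (p := p) ((-1) ^ k)).mul ((t1.add t2).add t3)
    rw [zero_add] at t
    convert t using 1
    simp only [hφ]
    rw [pow_mul (-1 : ℚ) p k, hodd.neg_one_pow]
    push_cast
    ring

end aux

/-- For an odd prime `p`, `s ≥ 0`, `n ≥ 1` and `1 ≤ m < p/2`,
`p^{2sn} tJ_{2s+2}(m p^n) ≡ p^{2s(n−1)} tJ_{2s+2}(m p^{n−1}) (mod p^n)`,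
i.e. the difference is zero or has `p`-adic valuation at least `n`. -/
theorem stmt10 (p : ℕ) (hp : p.Prime) (hodd : Odd p) (s n m : ℕ)
    (hn : 1 ≤ n) (hm : 1 ≤ m) (hmp : 2 * m < p) :
    (p : ℚ) ^ (2 * s * n) * tJeven s (m * p ^ n)
        = (p : ℚ) ^ (2 * s * (n - 1)) * tJeven s (m * p ^ (n - 1)) ∨
      (n : ℤ) ≤ padicValRat p ((p : ℚ) ^ (2 * s * n) * tJeven s (m * p ^ n)
        - (p : ℚ) ^ (2 * s * (n - 1)) * tJeven s (m * p ^ (n - 1))) := by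
  have : Fact p.Prime := ⟨hp⟩
  obtain ⟨r, rfl⟩ := Nat.exists_eq_add_of_le' hn
  rw [Nat.add_sub_cancel]
  apply DivP.final
  have e : m * p ^ (r + 1) = p * (m * p ^ r) := by ring
  rw [e]
  refine main_aux hodd (dvd_mul_left _ _) ?_
  have h : 2 * (p * (m * p ^ r)) = (2 * m) * p ^ (r + 1) := by ring
  rw [h, pow_succ p (r + 1), mul_comm (p ^ (r + 1)) p]
  exact Nat.mul_lt_mul_of_pos_right hmp (pow_pos hp.pos _)
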